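/- Let X = θ*Z + W with θ* ∈ ℝ^{n_x×n_z}, W ∈ ℝ^{n_x×N}, let Z ∈ ℝ^{n_z×N} have full row rank, let θ̂ = XZᵀ(ZZᵀ)⁻¹ be the ordinary least-squares estimate, set Δ = θ* − θ̂, and let κ ≥ 0. Then every θ ∈ Θ_N^κ satisfies (1/N)(θ − θ̂)ZZᵀ(θ − θ̂)ᵀ ⪯ (1 + κ/√N)² I_{n_x} − (1/N)(ΔZ + W)(ΔZ + W)ᵀ. -/

import Mathlib

open Matrix

/-- The uncertainty set `Θ_N^κ`: all parameter matrices `θ` with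
`(1/N)(X − θZ)(X − θZ)ᵀ ⪯ (1 + κ/√N)² I`. -/
def ThetaSet (nx nz N : ℕ) (X : Matrix (Fin nx) (Fin N) ℝ)
    (Z : Matrix (Fin nz) (Fin N) ℝ) (κ : ℝ) : Set (Matrix (Fin nx) (Fin nz) ℝ) :=
  {θ | (((1 + κ / Real.sqrt N) ^ 2 : ℝ) • (1 : Matrix (Fin nx) (Fin nx) ℝ) -
      ((N : ℝ)⁻¹) • ((X - θ * Z) * (X - θ * Z)ᵀ)).PosSemidef}

/-- Normal equations: the least-squares residual is orthogonal to the regressors. -/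
theorem leastSquares_residual_mul_transpose {m n p : Type*} [Fintype n] [DecidableEq n]
    [Fintype p] (X : Matrix m p ℝ) (Z : Matrix n p ℝ) (hZ : IsUnit (Z * Zᵀ).det) :
    (X - X * Zᵀ * (Z * Zᵀ)⁻¹ * Z) * Zᵀ = 0 := by
  rw [Matrix.sub_mul, Matrix.mul_assoc _ Z, Matrix.nonsing_inv_mul_cancel_right _ _ hZ, sub_self]

/-- Pythagorean identity for Gram matrices. -/
theorem sub_mul_mul_transpose_of_mul_transpose_eq_zero {m n p : Type*} [Fintype n] [Fintype p]
    (R : Matrix m p ℝ) (Z : Matrix n p ℝ) (D : Matrix m n ℝ) (h : R * Zᵀ = 0) :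
    (R - D * Z) * (R - D * Z)ᵀ = R * Rᵀ + D * (Z * Zᵀ) * Dᵀ := by
  have h' : Z * Rᵀ = 0 := by simpa using congrArg transpose h
  have h₁ : R * (D * Z)ᵀ = 0 := by
    rw [transpose_mul, ← Matrix.mul_assoc, h, Matrix.zero_mul]
  have h₂ : D * Z * Rᵀ = 0 := by rw [Matrix.mul_assoc, h', Matrix.mul_zero]
  rw [transpose_sub, Matrix.sub_mul, Matrix.mul_sub, Matrix.mul_sub, h₁, h₂, transpose_mul]
  simp [Matrix.mul_assoc]

/-- With `X = θ*Z + W`, `Z` of full row rank, `θ̂ = XZᵀ(ZZᵀ)⁻¹`,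
`Δ = θ* − θ̂` and `κ ≥ 0`, every `θ ∈ Θ_N^κ` satisfies
`(1/N)(θ − θ̂)ZZᵀ(θ − θ̂)ᵀ ⪯ (1 + κ/√N)² I − (1/N)(ΔZ + W)(ΔZ + W)ᵀ`. -/
theorem thetaSet_qmi_residual {nx nz N : ℕ} (hnx : 1 ≤ nx) (hnz : 1 ≤ nz) (hN : 1 ≤ N)
    (θstar : Matrix (Fin nx) (Fin nz) ℝ) (W : Matrix (Fin nx) (Fin N) ℝ)
    (Z : Matrix (Fin nz) (Fin N) ℝ) (hZ : IsUnit (Z * Zᵀ).det)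
    (X : Matrix (Fin nx) (Fin N) ℝ) (hX : X = θstar * Z + W)
    (θhat : Matrix (Fin nx) (Fin nz) ℝ) (hθhat : θhat = X * Zᵀ * (Z * Zᵀ)⁻¹)
    (Δ : Matrix (Fin nx) (Fin nz) ℝ) (hΔ : Δ = θstar - θhat)
    (κ : ℝ) (hκ : 0 ≤ κ) :
    ∀ θ ∈ ThetaSet nx nz N X Z κ,
      ((((1 + κ / Real.sqrt N) ^ 2 : ℝ) • (1 : Matrix (Fin nx) (Fin nx) ℝ) -
          ((N : ℝ)⁻¹) • ((Δ * Z + W) * (Δ * Z + W)ᵀ)) -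
        ((N : ℝ)⁻¹) • ((θ - θhat) * (Z * Zᵀ) * (θ - θhat)ᵀ)).PosSemidef := by
  intro θ hθ
  have hR : Δ * Z + W = X - θhat * Z := by
    rw [hΔ, hX, Matrix.sub_mul]
    abel
  have hE : X - θ * Z = (X - θhat * Z) - (θ - θhat) * Z := by
    rw [Matrix.sub_mul]
    abel
  have h0 : (X - θhat * Z) * Zᵀ = 0 := by
    rw [hθhat]
    exact leastSquares_residual_mul_transpose X Z hZ
  rw [ThetaSet, Set.mem_ofPred_eq, hE, sub_mul_mul_transpose_of_mul_transpose_eq_zero _ _ _ h0,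
    smul_add, ← sub_sub] at hθ
  rwa [hR]
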